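/- Let α be a badly approximable real number with convergents (pₙ/qₙ)_{n ≥ 1}. Assume there exist a positive rational number x and two sequences of finite words (U_k)_{k ≥ 1} and (V_k)_{k ≥ 1} over the positive integers such that, for every k ≥ 1, the continued fraction expansion of α begins with the block V_k, followed by U_k, followed by the mirror image Ū_k, and |U_{k+1}| > |U_k| ≥ x·|V_k|. Set M = limsup_{ℓ → ∞} q_ℓ^{1/ℓ} and m = liminf_{ℓ → ∞} q_ℓ^{1/ℓ}. If x > (3/2)·(log M)/(log m) − 1/2, then for every real number β equal to α up to a rational homography, i.e. β = (aα + b)/(cα + d) with integers a, b, c, d and ad − bc ≠ 0, one has inf_{q ≥ 1} q · ‖qα‖ · ‖qβ‖ = 0. -/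

import Mathlib

open Filter Topology

/-- Distance from a real number to the nearest integer. -/
noncomputable def nint (x : ℝ) : ℝ := |x - round x|

/-- A real number is badly approximable: `inf_{q ≥ 1} q·‖qα‖ > 0`. -/
def IsBad (α : ℝ) : Prop :=
  0 < ⨅ q : ℕ+, ((q : ℕ) : ℝ) * nint (((q : ℕ) : ℝ) * α)

/-- Denominators (continuants) of the continued fraction `[0; a 1, a 2, …]`:
`q 0 = 1`, `q 1 = a 1`, `q (j+2) = a (j+2) * q (j+1) + q j`. -/
def cfQ (a : ℕ → ℕ) : ℕ → ℕ
  | 0 => 1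
  | 1 => a 1
  | n + 2 => a (n + 2) * cfQ a (n + 1) + cfQ a n

/-- Numerators of the continued fraction `[0; a 1, a 2, …]`. -/
def cfP (a : ℕ → ℕ) : ℕ → ℕ
  | 0 => 0
  | 1 => 1
  | n + 2 => a (n + 2) * cfP a (n + 1) + cfP a n

/-- `a` (indexed from `1`) is the sequence of partial quotients of the continued
fraction expansion of `α`, i.e. `α = [0; a 1, a 2, …]`. -/
def IsCF (a : ℕ → ℕ) (α : ℝ) : Prop :=
  (∀ i, 1 ≤ i → 1 ≤ a i) ∧
    Tendsto (fun n => (cfP a n : ℝ) / (cfQ a n)) atTop (nhds α)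

section Continuants

variable {b : ℕ → ℕ}

lemma cfQ_pos (hb : ∀ i, 1 ≤ i → 1 ≤ b i) : ∀ n, 0 < cfQ b n
  | 0 => by simp [cfQ]
  | 1 => hb 1 le_rfl
  | n + 2 => by
    have := cfQ_pos hb n
    simp only [cfQ]
    omega

lemma cfQ_le_succ (hb : ∀ i, 1 ≤ i → 1 ≤ b i) : ∀ n, cfQ b n ≤ cfQ b (n + 1)
  | 0 => by simpa [cfQ] using hb 1 le_rfl
  | n + 1 => by
    have := Nat.mul_le_mul_right (cfQ b (n + 1)) (hb (n + 2) (by omega))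
    simp only [cfQ]
    omega

lemma cfQ_mono (hb : ∀ i, 1 ≤ i → 1 ≤ b i) : Monotone (cfQ b) :=
  monotone_nat_of_le_succ (cfQ_le_succ hb)

lemma two_mul_cfQ_le (hb : ∀ i, 1 ≤ i → 1 ≤ b i) (n : ℕ) : 2 * cfQ b n ≤ cfQ b (n + 2) := by
  have h₁ := Nat.mul_le_mul_right (cfQ b (n + 1)) (hb (n + 2) (by omega))
  have h₂ := cfQ_le_succ hb n
  simp only [cfQ]
  omega

lemma two_pow_le_two_mul_cfQ_sq (hb : ∀ i, 1 ≤ i → 1 ≤ b i) :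
    ∀ n, 2 ^ n ≤ 2 * cfQ b n ^ 2
  | 0 => by simp [cfQ]
  | 1 => by
    have := cfQ_pos hb 1
    nlinarith
  | n + 2 => by
    have h₁ := two_mul_cfQ_le hb n
    have h₂ := two_pow_le_two_mul_cfQ_sq hb n
    have h₃ := Nat.pow_le_pow_left h₁ 2
    rw [pow_add]
    nlinarith

lemma two_pow_le_cfQ_pow_four (hb : ∀ i, 1 ≤ i → 1 ≤ b i) {n : ℕ} (hn : 2 ≤ n) :
    2 ^ n ≤ cfQ b n ^ 4 := by
  have h₁ := two_pow_le_two_mul_cfQ_sq hb n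
  have h₂ : 2 ^ 2 ≤ 2 ^ n := Nat.pow_le_pow_right (by norm_num) hn
  have h₃ : 2 ^ n * 2 ^ n ≤ (2 * cfQ b n ^ 2) * (2 * cfQ b n ^ 2) := Nat.mul_le_mul h₁ h₁
  nlinarith

lemma cfP_mul_cfQ_sub (b : ℕ → ℕ) : ∀ n,
    (cfP b (n + 1) : ℝ) * cfQ b n - cfQ b (n + 1) * cfP b n = (-1) ^ n
  | 0 => by simp [cfP, cfQ]
  | n + 1 => by
    have h := cfP_mul_cfQ_sub b n
    simp only [cfP, cfQ] at h ⊢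
    push_cast
    rw [pow_succ]
    linear_combination -h

/-- Convergents beyond the index `c` stay within `1 / (q_c q_{c+1})` of the `c`-th one. -/
lemma abs_cfP_mul_cfQ_sub_le (b : ℕ → ℕ) (c : ℕ) : ∀ t,
    |(cfP b (c + t) : ℝ) * cfQ b c - cfQ b (c + t) * cfP b c| * cfQ b (c + 1) ≤ cfQ b (c + t)
  | 0 => by simp [mul_comm]
  | 1 => by rw [cfP_mul_cfQ_sub]; simp
  | t + 2 => by
    have h₁ := abs_cfP_mul_cfQ_sub_le b c t
    have h₂ := abs_cfP_mul_cfQ_sub_le b c (t + 1)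
    have eQ : (cfQ b (c + (t + 2)) : ℝ)
        = b (c + (t + 2)) * cfQ b (c + (t + 1)) + cfQ b (c + t) := mod_cast rfl
    have eP : (cfP b (c + (t + 2)) : ℝ)
        = b (c + (t + 2)) * cfP b (c + (t + 1)) + cfP b (c + t) := mod_cast rfl
    have e : (cfP b (c + (t + 2)) : ℝ) * cfQ b c - cfQ b (c + (t + 2)) * cfP b c
        = b (c + (t + 2)) * ((cfP b (c + (t + 1)) : ℝ) * cfQ b c - cfQ b (c + (t + 1)) * cfP b c)
          + ((cfP b (c + t) : ℝ) * cfQ b c - cfQ b (c + t) * cfP b c) := by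
      rw [eQ, eP]
      ring
    rw [e, eQ]
    refine (mul_le_mul_of_nonneg_right (abs_add_le _ _) (Nat.cast_nonneg _)).trans ?_
    rw [abs_mul, Nat.abs_cast, add_mul, mul_assoc]
    gcongr

lemma abs_div_sub_div_le (hb : ∀ i, 1 ≤ i → 1 ≤ b i) {c n : ℕ} (h : c ≤ n) :
    |(cfP b n : ℝ) / cfQ b n - cfP b c / cfQ b c| ≤ 1 / (cfQ b c * cfQ b (c + 1)) := by
  obtain ⟨t, rfl⟩ := Nat.exists_eq_add_of_le h
  have h₀ := abs_cfP_mul_cfQ_sub_le b c t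
  have h₁ : (0 : ℝ) < cfQ b c := by exact_mod_cast cfQ_pos hb c
  have h₂ : (0 : ℝ) < cfQ b (c + 1) := by exact_mod_cast cfQ_pos hb (c + 1)
  have h₃ : (0 : ℝ) < cfQ b (c + t) := by exact_mod_cast cfQ_pos hb (c + t)
  rw [div_sub_div _ _ h₃.ne' h₁.ne', abs_div, abs_of_pos (mul_pos h₃ h₁),
    div_le_div_iff₀ (mul_pos h₃ h₁) (mul_pos h₁ h₂)]
  nlinarith

lemma IsCF.abs_sub_le {a : ℕ → ℕ} {α : ℝ} (h : IsCF a α) (c : ℕ) :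
    |α - cfP a c / cfQ a c| ≤ 1 / (cfQ a c * cfQ a (c + 1)) := by
  refine le_of_tendsto ((h.2.sub_const _).abs) ?_
  filter_upwards [eventually_ge_atTop c] with n hn using abs_div_sub_div_le h.1 hn

lemma cfQ_congr {a : ℕ → ℕ} : ∀ {n : ℕ}, (∀ i, 1 ≤ i → i ≤ n → b i = a i) → cfQ b n = cfQ a n
  | 0, _ => rfl
  | 1, h => h 1 le_rfl le_rfl
  | n + 2, h => by
    simp only [cfQ]
    rw [h (n + 2) (by omega) le_rfl, cfQ_congr fun i hi hn => h i hi (by omega : i ≤ n + 2),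
      cfQ_congr fun i hi hn => h i hi (by omega : i ≤ n + 2)]

lemma cfP_congr {a : ℕ → ℕ} : ∀ {n : ℕ}, (∀ i, 1 ≤ i → i ≤ n → b i = a i) → cfP b n = cfP a n
  | 0, _ => rfl
  | 1, _ => rfl
  | n + 2, h => by
    simp only [cfP]
    rw [h (n + 2) (by omega) le_rfl, cfP_congr fun i hi hn => h i hi (by omega : i ≤ n + 2),
      cfP_congr fun i hi hn => h i hi (by omega : i ≤ n + 2)]

/-- If the expansion of `α` shares its first `c + 1` partial quotients with `b`, then every
convergent of `b` of index at least `c` is close to `α`. -/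
lemma IsCF.abs_cfQ_mul_sub_le {a : ℕ → ℕ} {α : ℝ} (h : IsCF a α)
    (hb : ∀ i, 1 ≤ i → 1 ≤ b i) {c n : ℕ} (hab : ∀ i, 1 ≤ i → i ≤ c + 1 → b i = a i)
    (hcn : c ≤ n) :
    |(cfQ b n : ℝ) * α - cfP b n| ≤ 2 * cfQ b n / (cfQ a c * cfQ a (c + 1)) := by
  have h₁ := h.abs_sub_le c
  have h₂ := abs_div_sub_div_le hb hcn
  have h₃ : (0 : ℝ) < cfQ b n := by exact_mod_cast cfQ_pos hb n
  have hab' : ∀ i, 1 ≤ i → i ≤ c → b i = a i := fun i hi hc => hab i hi (by omega)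
  rw [cfQ_congr (n := c + 1) hab, cfQ_congr (n := c) hab', cfP_congr (n := c) hab'] at h₂
  have e : (cfQ b n : ℝ) * α - cfP b n = cfQ b n * ((α - cfP a c / cfQ a c)
      - ((cfP b n : ℝ) / cfQ b n - cfP a c / cfQ a c)) := by
    field_simp
    ring
  rw [e, abs_mul, abs_of_pos h₃]
  calc _ ≤ (cfQ b n : ℝ) * (1 / (cfQ a c * cfQ a (c + 1)) + 1 / (cfQ a c * cfQ a (c + 1))) := by
        gcongr
        exact (abs_sub _ _).trans (add_le_add h₁ h₂)
    _ = _ := by ring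

/-- The product of the matrices `!![c, 1; 1, 0]` over the letters `c` of a word. -/
def wordMatrix (w : List ℕ) : Matrix (Fin 2) (Fin 2) ℕ :=
  (w.map fun c => !![c, 1; 1, 0]).prod

lemma wordMatrix_append (v w : List ℕ) :
    wordMatrix (v ++ w) = wordMatrix v * wordMatrix w := by
  simp [wordMatrix]

lemma wordMatrix_reverse (w : List ℕ) : wordMatrix w.reverse = (wordMatrix w).transpose := by
  have e : ∀ c : ℕ, (!![c, 1; 1, 0] : Matrix (Fin 2) (Fin 2) ℕ).transpose = !![c, 1; 1, 0] := by
    intro c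
    ext i j
    fin_cases i <;> fin_cases j <;> rfl
  simp [wordMatrix, Matrix.transpose_list_prod, Function.comp_def, e]

lemma wordMatrix_range_succ (b : ℕ → ℕ) : ∀ n,
    wordMatrix ((List.range (n + 1)).map fun i => b (i + 1))
      = !![cfQ b (n + 1), cfQ b n; cfP b (n + 1), cfP b n]
  | 0 => by simp [wordMatrix, cfQ, cfP]
  | n + 1 => by
    rw [List.range_succ, List.map_append, wordMatrix_append, wordMatrix_range_succ b n]
    ext i j
    fin_cases i <;> fin_cases j <;> simp [wordMatrix, cfQ, cfP, mul_comm]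

lemma wordMatrix_range_zero_zero (b : ℕ → ℕ) : ∀ n,
    wordMatrix ((List.range n).map fun i => b (i + 1)) 0 0 = cfQ b n
  | 0 => by simp [wordMatrix, cfQ]
  | n + 1 => by rw [wordMatrix_range_succ]; rfl

/-- For letters at least `1`, the top left entry is the largest of the first row. -/
lemma wordMatrix_zero_one_le {w : List ℕ} (hw : ∀ c ∈ w, 1 ≤ c) :
    wordMatrix w 0 1 ≤ wordMatrix w 0 0 := by
  induction w using List.reverseRecOn with
  | nil => simp [wordMatrix]
  | append_singleton v c ih =>
    have hc : 1 ≤ c := hw c (by simp)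
    have := Nat.mul_le_mul_left (wordMatrix v 0 0) hc
    rw [wordMatrix_append]
    simp only [wordMatrix, List.map_cons, List.map_nil, List.prod_cons, List.prod_nil, mul_one,
      Matrix.mul_apply, Fin.sum_univ_two, Matrix.of_apply, Matrix.cons_val', Matrix.cons_val_zero,
      Matrix.cons_val_one, Matrix.cons_val_fin_one, mul_zero, add_zero] at this ⊢
    omega

lemma wordMatrix_append_zero_zero_le {v w : List ℕ} (hv : ∀ c ∈ v, 1 ≤ c)
    (hw : ∀ c ∈ w, 1 ≤ c) :
    wordMatrix (v ++ w) 0 0 ≤ 2 * (wordMatrix v 0 0 * wordMatrix w 0 0) := by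
  have h₁ := wordMatrix_zero_one_le hv
  have h₂ := wordMatrix_zero_one_le (w := w.reverse) (by simpa using hw)
  rw [wordMatrix_reverse, Matrix.transpose_apply, Matrix.transpose_apply] at h₂
  have := Nat.mul_le_mul h₁ h₂
  rw [wordMatrix_append, Matrix.mul_apply, Fin.sum_univ_two]
  omega

end Continuants

lemma nint_nonneg (y : ℝ) : 0 ≤ nint y := abs_nonneg _

lemma nint_le (y : ℝ) (z : ℤ) : nint y ≤ |y - z| := round_le y z

lemma nint_natAbs_mul_le (z : ℤ) (y : ℝ) (k : ℤ) :
    nint ((z.natAbs : ℝ) * y) ≤ |(z : ℝ) * y - k| := by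
  rw [Nat.cast_natAbs, Int.cast_abs]
  rcases abs_choice (z : ℝ) with e | e <;> rw [e]
  · exact nint_le _ k
  · refine (nint_le _ (-k)).trans_eq ?_
    rw [← abs_neg]
    congr 1
    push_cast
    ring

lemma IsBad.exists_le {α : ℝ} (h : IsBad α) :
    ∃ δ > 0, ∀ q : ℕ, 1 ≤ q → δ ≤ q * nint (q * α) := by
  refine ⟨_, h, fun q hq => ?_⟩
  refine ciInf_le (f := fun q : ℕ+ => ((q : ℕ) : ℝ) * nint (((q : ℕ) : ℝ) * α)) ?_ ⟨q, hq⟩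
  exact ⟨0, by rintro _ ⟨q, rfl⟩; exact mul_nonneg (Nat.cast_nonneg _) (nint_nonneg _)⟩

lemma IsBad.mul_add_ne_zero {α : ℝ} (h : IsBad α) {C D : ℤ} (hCD : C ≠ 0 ∨ D ≠ 0) :
    (C : ℝ) * α + D ≠ 0 := by
  intro h₀
  obtain ⟨δ, hδ, hq⟩ := h.exists_le
  by_cases hC : C = 0
  · subst hC
    simp at h₀ hCD
    exact hCD h₀
  · have h₁ := hq C.natAbs (Int.natAbs_pos.2 hC)
    have h₂ : nint ((C.natAbs : ℝ) * α) ≤ 0 := by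
      refine (nint_natAbs_mul_le C α (-D)).trans_eq ?_
      rw [abs_eq_zero]
      push_cast
      linarith
    nlinarith [Nat.cast_nonneg (α := ℝ) C.natAbs]

/-- The continuants of a badly approximable number grow at most geometrically. -/
lemma IsBad.exists_cfQ_succ_le {α : ℝ} {a : ℕ → ℕ} (h : IsBad α) (hcf : IsCF a α) :
    ∃ K : ℝ, 1 ≤ K ∧ ∀ n, (cfQ a (n + 1) : ℝ) ≤ K * cfQ a n := by
  obtain ⟨δ, hδ, hq⟩ := h.exists_le
  have key : ∀ n, (cfQ a (n + 1) : ℝ) ≤ δ⁻¹ * cfQ a n := by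
    intro n
    have h₁ : (0 : ℝ) < cfQ a n := by exact_mod_cast cfQ_pos hcf.1 n
    have h₂ : (0 : ℝ) < cfQ a (n + 1) := by exact_mod_cast cfQ_pos hcf.1 (n + 1)
    have h₃ := hq _ (cfQ_pos hcf.1 n)
    have h₄ := hcf.abs_sub_le n
    have h₅ : nint (cfQ a n * α) ≤ 1 / cfQ a (n + 1) := by
      refine (nint_le _ (cfP a n)).trans ?_
      have e : (cfQ a n : ℝ) * α - ((cfP a n : ℤ) : ℝ)
          = cfQ a n * (α - cfP a n / cfQ a n) := by
        push_cast
        field_simp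
      rw [e, abs_mul, abs_of_pos h₁]
      calc _ ≤ (cfQ a n : ℝ) * (1 / (cfQ a n * cfQ a (n + 1))) := by gcongr
        _ = _ := by field_simp
    have h₆ : δ ≤ cfQ a n * (1 / cfQ a (n + 1)) := h₃.trans (by gcongr)
    rw [mul_one_div, le_div_iff₀ h₂] at h₆
    rw [← div_eq_inv_mul, le_div_iff₀ hδ]
    linarith
  refine ⟨max 1 δ⁻¹, le_max_left _ _, fun n => (key n).trans ?_⟩
  gcongr
  exact le_max_right _ _

/-- The growth condition on `x` forces `q_r ^ 3 / q_{r + 2 s}` to be small once `s ≥ x r` is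
large. -/
lemma exists_forall_pow_three_le {q : ℕ → ℝ} (h_one : ∀ n, 1 ≤ q n) (h_mono : Monotone q)
    {K : ℝ} (h_le : ∀ n, q n ≤ K ^ n) (h_ge : ∀ n, 2 ≤ n → 2 ^ n ≤ q n ^ 4)
    {x : ℝ} (hx : 0 < x)
    (hcond : (3 / 2) * Real.log (limsup (fun l : ℕ => q l ^ (1 / (l : ℝ))) atTop) /
      Real.log (liminf (fun l : ℕ => q l ^ (1 / (l : ℝ))) atTop) - 1 / 2 < x)
    {ε : ℝ} (hε : 0 < ε) :
    ∃ S : ℕ, ∀ r s : ℕ, S ≤ s → x * r ≤ s → q r ^ 3 ≤ ε * q (r + 2 * s) := by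
  set f : ℕ → ℝ := fun l => q l ^ (1 / (l : ℝ)) with hf
  have hpos : ∀ n, 0 < q n := fun n => zero_lt_one.trans_le (h_one n)
  have hfexp : ∀ l, f l = Real.exp (Real.log (q l) / l) := fun l => by
    rw [hf]
    simp only
    rw [Real.rpow_def_of_pos (hpos l), mul_one_div]
  have hup : ∀ᶠ l in atTop, f l ≤ Real.exp (Real.log K) := by
    filter_upwards [eventually_ge_atTop 1] with l hl
    have hl' : (0 : ℝ) < l := by exact_mod_cast hl
    rw [hfexp, Real.exp_le_exp, div_le_iff₀ hl', mul_comm, ← Real.log_pow]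
    exact Real.log_le_log (hpos l) (h_le l)
  have hlow : ∀ᶠ l in atTop, Real.exp (Real.log 2 / 4) ≤ f l := by
    filter_upwards [eventually_ge_atTop 2] with l hl
    have hl' : (0 : ℝ) < l := by exact_mod_cast (by omega : 0 < l)
    have := Real.log_le_log (by positivity) (h_ge l hl)
    rw [Real.log_pow, Real.log_pow] at this
    rw [hfexp, Real.exp_le_exp, div_le_div_iff₀ (by norm_num) hl']
    push_cast at this
    linarith
  have hbu : IsBoundedUnder (· ≤ ·) atTop f := isBoundedUnder_of_eventually_le hup
  have hbl : IsBoundedUnder (· ≥ ·) atTop f := isBoundedUnder_of_eventually_ge hlow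
  set M := limsup f atTop with hM
  set m := liminf f atTop with hm
  have hm₁ : Real.exp (Real.log 2 / 4) ≤ m := le_liminf_of_le hbu.isCoboundedUnder_ge hlow
  have hmM : m ≤ M := liminf_le_limsup hbu hbl
  have hm₀ : 0 < m := (Real.exp_pos _).trans_le hm₁
  have hM₀ : 0 < M := hm₀.trans_le hmM
  have hlogm : 0 < Real.log m := by
    have := (Real.le_log_iff_exp_le hm₀).2 hm₁
    have := Real.log_pos (one_lt_two)
    linarith
  have hcond' : 0 < (2 * x + 1) * Real.log m - 3 * Real.log M := by
    have h : (3 / 2) * Real.log M / Real.log m < x + 1 / 2 := by linarith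
    rw [div_lt_iff₀ hlogm] at h
    linarith
  obtain ⟨η, hη, hη'⟩ : ∃ η > 0,
      0 < (2 * x + 1) * (Real.log m - η) - 3 * (Real.log M + η) := by
    refine ⟨((2 * x + 1) * Real.log m - 3 * Real.log M) / (2 * (2 * x + 4)), by positivity, ?_⟩
    have e : (2 * x + 1) * (Real.log m
          - ((2 * x + 1) * Real.log m - 3 * Real.log M) / (2 * (2 * x + 4)))
        - 3 * (Real.log M + ((2 * x + 1) * Real.log m - 3 * Real.log M) / (2 * (2 * x + 4)))
        = ((2 * x + 1) * Real.log m - 3 * Real.log M) / 2 := by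
      field_simp
      ring
    rw [e]
    positivity
  set μ := Real.log m - η
  set lam := Real.log M + η
  have hlogM : Real.log m ≤ Real.log M := Real.log_le_log hm₀ hmM
  have hlam : 0 < lam := by simp only [lam]; linarith
  have hμlam : μ ≤ lam := by simp only [lam, μ]; linarith
  have hev₁ : ∀ᶠ l in atTop, f l < Real.exp lam := by
    refine eventually_lt_of_limsup_lt ?_ hbu
    rw [← hM, ← Real.log_lt_iff_lt_exp hM₀]
    simp only [lam]; linarith
  have hev₂ : ∀ᶠ l in atTop, Real.exp μ < f l := by
    refine eventually_lt_of_lt_liminf ?_ hbl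
    rw [← hm, ← Real.lt_log_iff_exp_lt hm₀]
    simp only [μ]; linarith
  obtain ⟨L, hL⟩ := eventually_atTop.1 (hev₁.and (hev₂.and (eventually_ge_atTop 1)))
  have hupper : ∀ n : ℕ, Real.log (q n) ≤ n * lam + Real.log (q L) := by
    intro n
    have hLn : 0 ≤ Real.log (q L) := Real.log_nonneg (h_one L)
    rcases le_total n L with h | h
    · have := Real.log_le_log (hpos n) (h_mono h)
      have : 0 ≤ n * lam := by positivity
      linarith
    · obtain ⟨h₁, -, h₂⟩ := hL n h
      have hn : (0 : ℝ) < n := by exact_mod_cast h₂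
      rw [hfexp, Real.exp_lt_exp, div_lt_iff₀ hn] at h₁
      linarith
  have hlower : ∀ n : ℕ, L ≤ n → n * μ ≤ Real.log (q n) := by
    intro n h
    obtain ⟨-, h₁, h₂⟩ := hL n h
    have hn : (0 : ℝ) < n := by exact_mod_cast h₂
    rw [hfexp, Real.exp_lt_exp, lt_div_iff₀ hn] at h₁
    linarith
  set gap := (2 * x + 1) * μ - 3 * lam
  obtain ⟨S, hS⟩ := exists_nat_ge ((3 * Real.log (q L) - Real.log ε) * x / gap)
  refine ⟨max S L, fun r s hs hrs => ?_⟩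
  have hs₁ : (S : ℝ) ≤ s := by exact_mod_cast (le_max_left _ _).trans hs
  have hs₂ : L ≤ r + 2 * s := by have := (le_max_right S L).trans hs; omega
  have h₁ := hupper r
  have h₂ := hlower _ hs₂
  push_cast at h₂
  rw [div_le_iff₀ hη'] at hS
  have h₃ : (3 * Real.log (q L) - Real.log ε) * x ≤ s * gap :=
    hS.trans (mul_le_mul_of_nonneg_right hs₁ hη'.le)
  have h₄ : (s : ℝ) * gap ≤ x * ((r + 2 * s) * μ - 3 * (r * lam)) := by
    have : 0 ≤ (s - x * r) * (3 * lam - μ) := mul_nonneg (by linarith) (by linarith)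
    simp only [gap]
    nlinarith
  have h₅ : 3 * Real.log (q L) - Real.log ε ≤ (r + 2 * s) * μ - 3 * (r * lam) := by
    refine le_of_mul_le_mul_right (h₃.trans (h₄.trans_eq (mul_comm _ _))) hx
  rw [← Real.log_le_log_iff (pow_pos (hpos r) 3) (mul_pos hε (hpos _)), Real.log_pow,
    Real.log_mul hε.ne' (hpos _).ne']
  push_cast
  linarith

lemma eq_map_range_of_getD {a : ℕ → ℕ} {w : List ℕ} {d : ℕ}
    (h : ∀ i < w.length, a (i + 1) = w.getD i d) :
    w = (List.range w.length).map fun i => a (i + 1) := by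
  refine List.ext_getElem (by simp) fun i h₁ h₂ => ?_
  simp [h i h₁, h₁]

/-- A prefix `V U Ū` of the expansion of `α` yields two consecutive convergents, with
denominators `Q` and `P`, of the palindrome `V U Ū V̄`. -/
lemma IsCF.exists_palindromic_approximation {a : ℕ → ℕ} {α : ℝ} (hcf : IsCF a α) {U V : List ℕ}
    (hpre : ∀ i < (V ++ U ++ U.reverse).length, a (i + 1) = (V ++ U ++ U.reverse).getD i 0)
    {c : ℕ} (hc : V.length + 2 * U.length = c + 1) :
    ∃ Q P P' : ℕ, 1 ≤ Q ∧ P ≤ Q ∧ Q ≤ 2 * (cfQ a (c + 1) * cfQ a V.length) ∧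
      |(Q : ℝ) * α - P| ≤ 2 * Q / (cfQ a c * cfQ a (c + 1)) ∧
      |(P : ℝ) * α - P'| ≤ 2 * Q / (cfQ a c * cfQ a (c + 1)) := by
  have hlen : (V ++ U ++ U.reverse).length = c + 1 := by simp; omega
  have hpm := eq_map_range_of_getD hpre
  have hpos : ∀ d ∈ V ++ U ++ U.reverse, 1 ≤ d := by
    intro d hd
    rw [hpm, List.mem_map] at hd
    obtain ⟨i, -, rfl⟩ := hd
    exact hcf.1 _ (by omega)
  have hV : V = (List.range V.length).map fun i => a (i + 1) := by
    refine eq_map_range_of_getD (d := 0) fun i hi => ?_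
    rw [hpre i (by simp; omega), List.append_assoc, List.getD_append _ _ _ _ hi]
  have hVpos : ∀ d ∈ V, 1 ≤ d := fun d hd => hpos d (by simp [hd])
  set w := V ++ U ++ U.reverse ++ V.reverse with hw
  have hwrev : w.reverse = w := by simp [hw]
  have hwpos : ∀ d ∈ w, 1 ≤ d := by
    intro d hd
    rcases List.mem_append.1 hd with h | h
    · exact hpos d h
    · exact hVpos d (by simpa using h)
  set b : ℕ → ℕ := fun i => w.getD (i - 1) 1 with hb
  have hbpos : ∀ i, 1 ≤ i → 1 ≤ b i := by
    intro i _
    rcases lt_or_ge (i - 1) w.length with h | h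
    · rw [hb]
      simp only
      rw [List.getD_eq_getElem _ _ h]
      exact hwpos _ (List.getElem_mem h)
    · rw [hb]
      simp only
      rw [List.getD_eq_default _ _ h]
  have hab : ∀ i, 1 ≤ i → i ≤ c + 1 → b i = a i := by
    intro i hi hic
    obtain ⟨j, rfl⟩ := Nat.exists_eq_add_of_le' hi
    have hj : j < (V ++ U ++ U.reverse).length := by omega
    rw [hpre j hj, hb, hw]
    simp only [Nat.add_sub_cancel]
    rw [List.getD_append _ _ _ _ hj, List.getD_eq_getElem _ _ hj, List.getD_eq_getElem _ _ hj]
  have hwlen : w.length = c + V.length + 1 := by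
    rw [hw, List.length_append, hlen, List.length_reverse]
    omega
  have hwm : wordMatrix w
      = !![cfQ b (c + V.length + 1), cfQ b (c + V.length);
          cfP b (c + V.length + 1), cfP b (c + V.length)] := by
    rw [← wordMatrix_range_succ, ← hwlen]
    congr 1
    exact eq_map_range_of_getD (d := 1) fun i _ => by simp [hb]
  have hsymm : cfP b (c + V.length + 1) = cfQ b (c + V.length) := by
    have h := congrFun (congrFun (wordMatrix_reverse w) 1) 0
    rw [hwrev, Matrix.transpose_apply, hwm] at h
    simpa using h
  have hQ : cfQ b (c + V.length + 1) ≤ 2 * (cfQ a (c + 1) * cfQ a V.length) := by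
    have h := wordMatrix_append_zero_zero_le (w := V.reverse) hpos (by simpa using hVpos)
    rw [← hw, hwm, wordMatrix_reverse, Matrix.transpose_apply, hpm, hlen] at h
    rw [hV] at h
    simpa only [wordMatrix_range_zero_zero, List.length_map, List.length_range, Matrix.of_apply,
      Matrix.cons_val', Matrix.cons_val_zero] using h
  refine ⟨cfQ b (c + V.length + 1), cfP b (c + V.length + 1), cfP b (c + V.length),
    cfQ_pos hbpos _, ?_, hQ, hcf.abs_cfQ_mul_sub_le hbpos hab (by omega), ?_⟩
  · rw [hsymm]
    exact cfQ_le_succ hbpos _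
  · rw [hsymm]
    refine (hcf.abs_cfQ_mul_sub_le hbpos hab (by omega)).trans ?_
    gcongr
    exact cfQ_le_succ hbpos _

/-- If `P / Q` and `P' / P` are both good approximations of `α`, then `|C P + D Q|` is a good
denominator both for `α` and for `(A α + B) / (C α + D)`. -/
lemma exists_mul_nint_mul_nint_le {α β E : ℝ} {A B C D : ℤ} {Q P P' : ℕ}
    (hγ : (C : ℝ) * α + D ≠ 0) (hQ : 1 ≤ Q) (hPQ : P ≤ Q) (hQα : |(Q : ℝ) * α - P| ≤ E)
    (hPα : |(P : ℝ) * α - P'| ≤ E) (hE : |(C : ℝ)| * E < Q * |(C : ℝ) * α + D|)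
    (hβ : β = ((A : ℝ) * α + B) / ((C : ℝ) * α + D)) :
    ∃ q : ℕ, 1 ≤ q ∧ (q : ℝ) * nint (q * α) * nint (q * β) ≤
      (|(C : ℝ)| + |(D : ℝ)|) * Q * ((|(C : ℝ)| + |(D : ℝ)|) * E) *
        (|(A : ℝ) * D - B * C| / |(C : ℝ) * α + D| * E) := by
  have hE₀ : 0 ≤ E := (abs_nonneg _).trans hQα
  have hQ₀ : (0 : ℝ) < Q := by exact_mod_cast hQ
  set z : ℤ := C * P + D * Q with hz
  have hz' : (z : ℝ) = C * P + D * Q := by rw [hz]; push_cast; ring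
  have hz₀ : z ≠ 0 := by
    intro h
    have h₀ : (C : ℝ) * P + D * Q = 0 := by rw [← hz', h, Int.cast_zero]
    have h₁ : (Q : ℝ) * (C * α + D) = C * (Q * α - P) := by linear_combination h₀
    have h₂ : (Q : ℝ) * |(C : ℝ) * α + D| ≤ |(C : ℝ)| * E := by
      rw [← abs_of_pos hQ₀, ← abs_mul, h₁, abs_mul]
      gcongr
    linarith
  refine ⟨z.natAbs, Int.natAbs_pos.2 hz₀, ?_⟩
  have h₁ : (z.natAbs : ℝ) ≤ (|(C : ℝ)| + |(D : ℝ)|) * Q := by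
    rw [Nat.cast_natAbs, Int.cast_abs, hz']
    refine (abs_add_le _ _).trans ?_
    rw [abs_mul, abs_mul, Nat.abs_cast, Nat.abs_cast, add_mul]
    gcongr
  have h₂ : nint ((z.natAbs : ℝ) * α) ≤ (|(C : ℝ)| + |(D : ℝ)|) * E := by
    refine (nint_natAbs_mul_le z α (C * P' + D * P)).trans ?_
    have e : (z : ℝ) * α - ((C * P' + D * P : ℤ) : ℝ)
        = C * (P * α - P') + D * (Q * α - P) := by
      rw [hz']
      push_cast
      ring
    rw [e]
    refine (abs_add_le _ _).trans ?_
    rw [abs_mul, abs_mul, add_mul]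
    gcongr
  have h₃ : nint ((z.natAbs : ℝ) * β)
      ≤ |(A : ℝ) * D - B * C| / |(C : ℝ) * α + D| * E := by
    refine (nint_natAbs_mul_le z β (A * P + B * Q)).trans ?_
    have e : (z : ℝ) * β - ((A * P + B * Q : ℤ) : ℝ)
        = (A * D - B * C) / (C * α + D) * (Q * α - P) := by
      rw [hz', hβ]
      push_cast
      field_simp
      ring
    rw [e, abs_mul, abs_div]
    gcongr
  have h₄ := nint_nonneg ((z.natAbs : ℝ) * α)
  have h₅ := nint_nonneg ((z.natAbs : ℝ) * β)
  gcongr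

/-- Theorem 5 of Adamczewski–Bugeaud.  Let `α` be badly
approximable with continued fraction expansion `a` and convergent denominators
`cfQ a`.  Suppose there are a positive rational `x` and finite words
`U k`, `V k`, with `|U (k+1)| > |U k| ≥ x·|V k|`, such that for each `k` the
expansion of `α` begins with the block `V k`, followed by `U k`, followed by
the mirror image of `U k`.  Put `M = limsup (q_ℓ)^{1/ℓ}` and
`m = liminf (q_ℓ)^{1/ℓ}`.  If `x > (3/2)·log M / log m - 1/2`, then for every
`β` equal to `α` up to a rational homography,
`inf_{q ≥ 1} q·‖qα‖·‖qβ‖ = 0`. -/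
theorem littlewood_of_palindromic_blocks
    (α : ℝ) (a : ℕ → ℕ) (hcf : IsCF a α) (hbad : IsBad α)
    (x : ℚ) (hx : 0 < x) (U V : ℕ → List ℕ)
    (hpre : ∀ k : ℕ, 1 ≤ k →
      ∀ i < (V k ++ U k ++ (U k).reverse).length,
        a (i + 1) = (V k ++ U k ++ (U k).reverse).getD i 0)
    (hlen₁ : ∀ k : ℕ, 1 ≤ k → (U k).length < (U (k + 1)).length)
    (hlen₂ : ∀ k : ℕ, 1 ≤ k → x * ((V k).length : ℚ) ≤ ((U k).length : ℚ))
    (M m : ℝ)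
    (hM : M = limsup (fun l : ℕ => (cfQ a l : ℝ) ^ (1 / (l : ℝ))) atTop)
    (hm : m = liminf (fun l : ℕ => (cfQ a l : ℝ) ^ (1 / (l : ℝ))) atTop)
    (hcond : (3 / 2) * Real.log M / Real.log m - 1 / 2 < (x : ℝ))
    (β : ℝ) (A B C D : ℤ) (hdet : A * D - B * C ≠ 0)
    (hβ : β = ((A : ℝ) * α + B) / ((C : ℝ) * α + D)) :
    (⨅ q : ℕ+, ((q : ℕ) : ℝ) * nint (((q : ℕ) : ℝ) * α) *
        nint (((q : ℕ) : ℝ) * β)) = 0 := by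
  have hCD : C ≠ 0 ∨ D ≠ 0 := by
    by_contra! h
    simp [h.1, h.2] at hdet
  have hγ := hbad.mul_add_ne_zero hCD
  obtain ⟨K, hK, hKq⟩ := hbad.exists_cfQ_succ_le hcf
  have hpow : ∀ n, (cfQ a n : ℝ) ≤ K ^ n := by
    intro n
    induction n with
    | zero => simp [cfQ]
    | succ n ih =>
      rw [pow_succ']
      exact (hKq n).trans (by gcongr)
  have hU : ∀ k, k ≤ (U (k + 1)).length := by
    intro k
    induction k with
    | zero => exact Nat.zero_le _
    | succ k ih => exact Nat.succ_le_of_lt (ih.trans_lt (hlen₁ (k + 1) (by omega)))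
  have hnonneg : ∀ q : ℕ+, 0 ≤ ((q : ℕ) : ℝ) * nint (((q : ℕ) : ℝ) * α) *
      nint (((q : ℕ) : ℝ) * β) := fun q =>
    mul_nonneg (mul_nonneg (Nat.cast_nonneg _) (nint_nonneg _)) (nint_nonneg _)
  refine le_antisymm (le_of_forall_pos_le_add fun ε hε => ?_) (le_ciInf hnonneg)
  set γ : ℝ := (C : ℝ) * α + D with hγdef
  set κ : ℝ := |(C : ℝ)| + |(D : ℝ)| with hκ
  set Δ : ℝ := |(A : ℝ) * D - B * C| with hΔ
  have hγ₀ : 0 < |γ| := abs_pos.2 hγ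
  obtain ⟨T, hT, hT₁, hT₂⟩ : ∃ T > 0, 2 * |(C : ℝ)| * T < |γ| ∧
      32 * K ^ 2 * κ ^ 2 * (Δ / |γ|) * T ≤ ε := by
    have hκ₀ : 0 ≤ κ := by positivity
    have hΔ₀ : 0 ≤ Δ := abs_nonneg _
    have h₁ : 0 < |γ| / (2 * |(C : ℝ)| + 1) := by positivity
    have h₂ : 0 < ε / (32 * K ^ 2 * κ ^ 2 * (Δ / |γ|) + 1) := by positivity
    refine ⟨min (|γ| / (2 * |(C : ℝ)| + 1)) (ε / (32 * K ^ 2 * κ ^ 2 * (Δ / |γ|) + 1)),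
      lt_min h₁ h₂, ?_, ?_⟩
    · refine (mul_le_mul_of_nonneg_left (min_le_left _ _) (by positivity)).trans_lt ?_
      rw [mul_div_assoc', div_lt_iff₀ (by positivity)]
      nlinarith
    · refine (mul_le_mul_of_nonneg_left (min_le_right _ _) (by positivity)).trans ?_
      rw [mul_div_assoc', div_le_iff₀ (by positivity)]
      nlinarith
  have hone : ∀ n, (1 : ℝ) ≤ cfQ a n := fun n => by exact_mod_cast cfQ_pos hcf.1 n
  rw [hM, hm] at hcond
  obtain ⟨S, hS⟩ := exists_forall_pow_three_le (q := fun n => (cfQ a n : ℝ)) hone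
    (fun i j h => Nat.cast_le.2 (cfQ_mono hcf.1 h)) hpow
    (fun n hn => by exact_mod_cast two_pow_le_cfQ_pow_four hcf.1 hn)
    (x := (x : ℝ)) (by exact_mod_cast hx) hcond hT
  obtain ⟨k, hk₁, hkS, hkU⟩ : ∃ k, 1 ≤ k ∧ S ≤ (U k).length ∧ 1 ≤ (U k).length :=
    ⟨S + 1 + 1, by omega, (Nat.le_succ S).trans (hU _), le_trans (by omega) (hU (S + 1))⟩
  obtain ⟨c, hc⟩ : ∃ c, (V k).length + 2 * (U k).length = c + 1 :=
    ⟨(V k).length + 2 * (U k).length - 1, by omega⟩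
  have hsmall := hS (V k).length (U k).length hkS (by exact_mod_cast hlen₂ k hk₁)
  simp only [hc] at hsmall
  obtain ⟨Q, P, P', hQ₁, hPQ, hQle, hQα, hPα⟩ :=
    hcf.exists_palindromic_approximation (hpre k hk₁) hc
  set N : ℝ := (cfQ a (c + 1) : ℝ) with hN
  set R : ℝ := (cfQ a (V k).length : ℝ) with hR
  have hN₁ : 1 ≤ N := hone _
  have hR₁ : 1 ≤ R := hone _
  have hc₁ : (1 : ℝ) ≤ cfQ a c := hone _
  have hQR : (Q : ℝ) ≤ 2 * (N * R) := by
    rw [hN, hR]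
    exact_mod_cast hQle
  have hNT : 1 ≤ T * N := (one_le_pow₀ hR₁).trans hsmall
  have hQ₀ : (0 : ℝ) < Q := by exact_mod_cast hQ₁
  obtain ⟨q, hq, hqle⟩ := exists_mul_nint_mul_nint_le hγ hQ₁ hPQ hQα hPα (by
    rw [mul_div_assoc', div_lt_iff₀ (by positivity)]
    have h₁ : N ≤ cfQ a c * N := le_mul_of_one_le_left (by linarith) hc₁
    have h₂ : 2 * |(C : ℝ)| ≤ 2 * |(C : ℝ)| * (T * N) :=
      le_mul_of_one_le_right (by positivity) hNT
    have h₃ : 2 * |(C : ℝ)| * T * N < |γ| * N := mul_lt_mul_of_pos_right hT₁ (by linarith)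
    have h₄ : |γ| * N ≤ |γ| * (cfQ a c * N) := mul_le_mul_of_nonneg_left h₁ hγ₀.le
    have h₅ : 2 * |(C : ℝ)| < |γ| * (cfQ a c * N) := by linarith
    have h₆ := mul_lt_mul_of_pos_left h₅ hQ₀
    linarith) hβ
  have hE : 2 * (Q : ℝ) / (cfQ a c * N) ≤ 4 * K * R / N := by
    have h₁ : N ≤ K * cfQ a c := hKq c
    rw [div_le_div_iff₀ (by positivity) (by positivity)]
    have h₂ : N * (R * N) ≤ N * (R * (K * cfQ a c)) := by gcongr
    have h₃ : (Q : ℝ) * N ≤ 2 * (N * R) * N := by gcongr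
    linarith
  refine (ciInf_le ⟨0, by rintro _ ⟨q, rfl⟩; exact hnonneg q⟩ (⟨q, hq⟩ : ℕ+)).trans ?_
  rw [zero_add]
  calc _ ≤ κ * Q * (κ * (2 * Q / (cfQ a c * N))) * (Δ / |γ| * (2 * Q / (cfQ a c * N))) := hqle
    _ ≤ κ * (2 * (N * R)) * (κ * (4 * K * R / N)) * (Δ / |γ| * (4 * K * R / N)) := by gcongr
    _ = 32 * K ^ 2 * κ ^ 2 * (Δ / |γ|) * (R ^ 3 / N) := by
      field_simp
      ring
    _ ≤ 32 * K ^ 2 * κ ^ 2 * (Δ / |γ|) * T := by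
      gcongr
      rw [div_le_iff₀ (by positivity)]
      exact hsmall
    _ ≤ ε := hT₂
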